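/- The Gibbs posterior ρ̂_λ, defined by dρ̂_λ/dπ (θ) = exp(−λ r(θ)) / E_{ϑ∼π}[exp(−λ r(ϑ))], is the minimizer over ρ ∈ P(Θ) of E_{θ∼ρ}[r(θ)] + KL(ρ‖π)/λ. As a consequence, for any λ > 0 and any ε ∈ (0,1), with probability at least 1 − ε over the sample S: E_{θ∼ρ̂_λ}[R(θ)] ≤ inf over ρ ∈ P(Θ) of ( E_{θ∼ρ}[r(θ)] + λC²/(8n) + ( KL(ρ‖π) + log(1/ε) ) / λ ). -/

import Mathlib

open MeasureTheory
open scoped ENNReal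

/- Kullback-Leibler divergence: `∫ log (dρ/dπ) dρ` when `ρ ≪ π` (and the integral is
well-defined), `+∞` otherwise. -/
open Classical in
noncomputable def KL {Θ : Type*} [MeasurableSpace Θ] (ρ π : Measure Θ) : ℝ≥0∞ :=
  if ρ ≪ π ∧ Integrable (fun θ => Real.log ((ρ.rnDeriv π) θ).toReal) ρ
  then ENNReal.ofReal (∫ θ, Real.log ((ρ.rnDeriv π) θ).toReal ∂ρ)
  else ⊤

/- The risk `R(θ) = E_{(X,Y)∼P}[ℓ(f_θ(X),Y)]`. -/
noncomputable def risk {X Y Θ : Type*} [MeasurableSpace X] [MeasurableSpace Y]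
    (P : Measure (X × Y)) (f : Θ → X → Y) (ℓ : Y → Y → ℝ) (θ : Θ) : ℝ :=
  ∫ p, ℓ (f θ p.1) p.2 ∂P

/- The empirical risk `r(θ) = (1/n) ∑ᵢ ℓ(f_θ(Xᵢ),Yᵢ)` on the sample `ω`. -/
noncomputable def empRisk {X Y Θ : Type*} (f : Θ → X → Y) (ℓ : Y → Y → ℝ)
    (n : ℕ) (ω : Fin n → X × Y) (θ : Θ) : ℝ :=
  (∑ i, ℓ (f θ (ω i).1) (ω i).2) / n

/- The Gibbs posterior `ρ̂_λ`, with density proportional to `exp (-λ r θ)` w.r.t. `π`. -/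
noncomputable def gibbs {X Y Θ : Type*} [MeasurableSpace Θ] (π : Measure Θ)
    (f : Θ → X → Y) (ℓ : Y → Y → ℝ) (lam : ℝ) (n : ℕ) (ω : Fin n → X × Y) : Measure Θ :=
  π.tilted (fun θ => -lam * empRisk f ℓ n ω θ)

open ProbabilityTheory

theorem integrable_of_measurable_of_mem_Icc {Ω : Type*} [MeasurableSpace Ω] (μ : Measure Ω)
    [IsFiniteMeasure μ] {g : Ω → ℝ} {a b : ℝ} (hg : Measurable g)
    (hb : ∀ x, g x ∈ Set.Icc a b) : Integrable g μ :=
  Integrable.of_mem_Icc a b hg.aemeasurable (Filter.Eventually.of_forall hb)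

theorem integrable_exp_of_measurable_of_mem_Icc {Ω : Type*} [MeasurableSpace Ω] (μ : Measure Ω)
    [IsFiniteMeasure μ] {g : Ω → ℝ} {a b : ℝ} (hg : Measurable g)
    (hb : ∀ x, g x ∈ Set.Icc a b) : Integrable (fun x => Real.exp (g x)) μ :=
  integrable_of_measurable_of_mem_Icc μ (a := Real.exp a) (b := Real.exp b) hg.exp fun x =>
    ⟨Real.exp_le_exp.2 (hb x).1, Real.exp_le_exp.2 (hb x).2⟩

theorem KL_eq_ofReal_integral_llr {Θ : Type*} [MeasurableSpace Θ] {ρ π : Measure Θ}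
    (hac : ρ ≪ π) (hint : Integrable (llr ρ π) ρ) :
    KL ρ π = ENNReal.ofReal (∫ θ, llr ρ π θ ∂ρ) := by
  rw [KL, if_pos ⟨hac, hint⟩]
  rfl

theorem KL_eq_top {Θ : Type*} [MeasurableSpace Θ] {ρ π : Measure Θ}
    (h : ¬ (ρ ≪ π ∧ Integrable (llr ρ π) ρ)) : KL ρ π = ⊤ := by
  rw [KL]
  exact if_neg h

theorem integral_llr_nonneg {Θ : Type*} [MeasurableSpace Θ] {ρ π : Measure Θ}
    [IsProbabilityMeasure ρ] [IsProbabilityMeasure π] (hac : ρ ≪ π)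
    (hint : Integrable (llr ρ π) ρ) : 0 ≤ ∫ θ, llr ρ π θ ∂ρ := by
  simpa using InformationTheory.integral_llr_add_sub_measure_univ_nonneg hac hint

/-- The Donsker–Varadhan inequality. -/
theorem integral_sub_log_integral_exp_le_integral_llr {Θ : Type*} [MeasurableSpace Θ]
    {ρ π : Measure Θ} [IsProbabilityMeasure ρ] [IsProbabilityMeasure π] (hac : ρ ≪ π)
    (hint : Integrable (llr ρ π) ρ) {g : Θ → ℝ} (hgρ : Integrable g ρ)
    (hgπ : Integrable (fun θ => Real.exp (g θ)) π) :
    ∫ θ, g θ ∂ρ - Real.log (∫ θ, Real.exp (g θ) ∂π) ≤ ∫ θ, llr ρ π θ ∂ρ := by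
  have : IsProbabilityMeasure (π.tilted g) := isProbabilityMeasure_tilted hgπ
  have h := integral_llr_nonneg (hac.trans (absolutelyContinuous_tilted hgπ))
    (integrable_llr_tilted_right hac hgρ hint hgπ)
  rw [integral_llr_tilted_right hac hgρ hgπ hint] at h
  linarith

theorem llr_tilted_self_ae_eq {Θ : Type*} [MeasurableSpace Θ] {π : Measure Θ}
    [IsProbabilityMeasure π] {g : Θ → ℝ} (hgπ : Integrable (fun θ => Real.exp (g θ)) π) :
    llr (π.tilted g) π =ᵐ[π.tilted g] fun θ => g θ - Real.log (∫ θ, Real.exp (g θ) ∂π) :=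
  (tilted_absolutelyContinuous π g).ae_le (log_rnDeriv_tilted_left_self hgπ)

theorem integrable_llr_tilted_self {Θ : Type*} [MeasurableSpace Θ] {π : Measure Θ}
    [IsProbabilityMeasure π] {g : Θ → ℝ} (hgπ : Integrable (fun θ => Real.exp (g θ)) π)
    (hg : Integrable g (π.tilted g)) : Integrable (llr (π.tilted g) π) (π.tilted g) := by
  have : IsProbabilityMeasure (π.tilted g) := isProbabilityMeasure_tilted hgπ
  rw [integrable_congr (llr_tilted_self_ae_eq hgπ)]
  exact hg.sub (integrable_const _)

theorem integral_llr_tilted_self {Θ : Type*} [MeasurableSpace Θ] {π : Measure Θ}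
    [IsProbabilityMeasure π] {g : Θ → ℝ} (hgπ : Integrable (fun θ => Real.exp (g θ)) π)
    (hg : Integrable g (π.tilted g)) :
    ∫ θ, llr (π.tilted g) π θ ∂(π.tilted g) =
      ∫ θ, g θ ∂(π.tilted g) - Real.log (∫ θ, Real.exp (g θ) ∂π) := by
  have : IsProbabilityMeasure (π.tilted g) := isProbabilityMeasure_tilted hgπ
  rw [integral_congr_ae (llr_tilted_self_ae_eq hgπ), integral_sub hg (integrable_const _)]
  simp

theorem lintegral_ofReal_add_KL_div {Θ : Type*} [MeasurableSpace Θ] {ρ π : Measure Θ}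
    [IsProbabilityMeasure ρ] [IsProbabilityMeasure π] (hac : ρ ≪ π)
    (hint : Integrable (llr ρ π) ρ) {h : Θ → ℝ} (hh : Integrable h ρ) (h0 : ∀ θ, 0 ≤ h θ)
    {lam : ℝ} (hlam : 0 < lam) :
    (∫⁻ θ, ENNReal.ofReal (h θ) ∂ρ) + KL ρ π / ENNReal.ofReal lam =
      ENNReal.ofReal (∫ θ, h θ ∂ρ + (∫ θ, llr ρ π θ ∂ρ) / lam) := by
  rw [KL_eq_ofReal_integral_llr hac hint, ← ENNReal.ofReal_div_of_pos hlam,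
    ← ofReal_integral_eq_lintegral_ofReal hh (Filter.Eventually.of_forall h0),
    ENNReal.ofReal_add (integral_nonneg h0)
      (div_nonneg (integral_llr_nonneg hac hint) hlam.le)]

/-- The Gibbs measure `π.tilted (-λ h)` minimizes `ρ ↦ E_ρ[h] + KL(ρ‖π)/λ`. -/
theorem tilted_minimizes_lintegral_add_KL_div {Θ : Type*} [MeasurableSpace Θ] (π : Measure Θ)
    [IsProbabilityMeasure π] {h : Θ → ℝ} {C : ℝ} (hh : Measurable h)
    (hb : ∀ θ, h θ ∈ Set.Icc 0 C) {lam : ℝ} (hlam : 0 < lam) (ρ : Measure Θ)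
    [IsProbabilityMeasure ρ] :
    (∫⁻ θ, ENNReal.ofReal (h θ) ∂(π.tilted fun θ => -lam * h θ))
        + KL (π.tilted fun θ => -lam * h θ) π / ENNReal.ofReal lam ≤
      (∫⁻ θ, ENNReal.ofReal (h θ) ∂ρ) + KL ρ π / ENNReal.ofReal lam := by
  by_cases hρ : ρ ≪ π ∧ Integrable (llr ρ π) ρ
  swap
  · rw [KL_eq_top hρ, ENNReal.top_div_of_ne_top ENNReal.ofReal_ne_top]
    simp
  obtain ⟨hac, hint⟩ := hρ
  have hexp : Integrable (fun θ => Real.exp (-lam * h θ)) π := by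
    refine integrable_exp_of_measurable_of_mem_Icc π (a := -lam * C) (b := 0)
      (hh.const_mul _) fun θ => ⟨?_, ?_⟩
    · nlinarith [(hb θ).2]
    · nlinarith [(hb θ).1]
  have : IsProbabilityMeasure (π.tilted fun θ => -lam * h θ) := isProbabilityMeasure_tilted hexp
  have hi : ∀ (μ : Measure Θ) [IsFiniteMeasure μ], Integrable h μ := fun μ _ =>
    integrable_of_measurable_of_mem_Icc μ hh hb
  have h0 : ∀ θ, 0 ≤ h θ := fun θ => (hb θ).1
  rw [lintegral_ofReal_add_KL_div hac hint (hi _) h0 hlam,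
    lintegral_ofReal_add_KL_div (tilted_absolutelyContinuous _ _)
      (integrable_llr_tilted_self hexp ((hi _).const_mul _)) (hi _) h0 hlam,
    integral_llr_tilted_self hexp ((hi _).const_mul _)]
  have hdv := integral_sub_log_integral_exp_le_integral_llr hac hint
    ((hi ρ).const_mul (-lam)) hexp
  rw [integral_const_mul] at hdv ⊢
  apply ENNReal.ofReal_le_ofReal
  calc _ = -Real.log (∫ θ, Real.exp (-lam * h θ) ∂π) / lam := by field_simp; ring
    _ ≤ _ := by
      rw [div_le_iff₀ hlam, add_mul, div_mul_cancel₀ _ hlam.ne']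
      linarith

/-- A change of measure: `E_ρ[R] ≤ E_ρ[r] + (KL(ρ‖π) + L)/λ` as soon as
`log E_π[exp (λ (R - r))] ≤ L`. -/
theorem lintegral_le_of_log_integral_exp_le {Θ : Type*} [MeasurableSpace Θ] {π : Measure Θ}
    [IsProbabilityMeasure π] {R r : Θ → ℝ} {C : ℝ} (hR : Measurable R) (hr : Measurable r)
    (hRb : ∀ θ, R θ ∈ Set.Icc 0 C) (hrb : ∀ θ, r θ ∈ Set.Icc 0 C) {lam a L : ℝ}
    (hlam : 0 < lam) (ha : 0 ≤ a) (hL : 0 ≤ L)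
    (hlog : Real.log (∫ θ, Real.exp (lam * (R θ - r θ)) ∂π) ≤ lam * a + L)
    (ρ : Measure Θ) [IsProbabilityMeasure ρ] :
    ∫⁻ θ, ENNReal.ofReal (R θ) ∂ρ ≤ (∫⁻ θ, ENNReal.ofReal (r θ) ∂ρ) + ENNReal.ofReal a
      + (KL ρ π + ENNReal.ofReal L) / ENNReal.ofReal lam := by
  by_cases hρ : ρ ≪ π ∧ Integrable (llr ρ π) ρ
  swap
  · rw [KL_eq_top hρ, top_add, ENNReal.top_div_of_ne_top ENNReal.ofReal_ne_top]
    simp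
  obtain ⟨hac, hint⟩ := hρ
  have hRi : Integrable R ρ := integrable_of_measurable_of_mem_Icc ρ hR hRb
  have hri : Integrable r ρ := integrable_of_measurable_of_mem_Icc ρ hr hrb
  have hexp : Integrable (fun θ => Real.exp (lam * (R θ - r θ))) π := by
    refine integrable_exp_of_measurable_of_mem_Icc π (a := lam * (0 - C)) (b := lam * (C - 0))
      ((hR.sub hr).const_mul _) fun θ => ⟨?_, ?_⟩
    · exact mul_le_mul_of_nonneg_left (sub_le_sub (hRb θ).1 (hrb θ).2) hlam.le
    · exact mul_le_mul_of_nonneg_left (sub_le_sub (hRb θ).2 (hrb θ).1) hlam.le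
  have hdv := integral_sub_log_integral_exp_le_integral_llr hac hint
    ((hRi.sub hri).const_mul lam) hexp
  simp only [Pi.sub_apply] at hdv
  rw [integral_const_mul, integral_sub hRi hri] at hdv
  have hkl := integral_llr_nonneg hac hint
  have hr0 : 0 ≤ ∫ θ, r θ ∂ρ := integral_nonneg fun θ => (hrb θ).1
  rw [KL_eq_ofReal_integral_llr hac hint, ← ENNReal.ofReal_add hkl hL,
    ← ENNReal.ofReal_div_of_pos hlam,
    ← ofReal_integral_eq_lintegral_ofReal hRi (Filter.Eventually.of_forall fun θ => (hRb θ).1),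
    ← ofReal_integral_eq_lintegral_ofReal hri (Filter.Eventually.of_forall fun θ => (hrb θ).1),
    ← ENNReal.ofReal_add hr0 ha, ← ENNReal.ofReal_add (by positivity) (by positivity)]
  apply ENNReal.ofReal_le_ofReal
  rw [← sub_le_iff_le_add', le_div_iff₀ hlam]
  linarith

/-- Hoeffding's lemma for the deviation of an empirical mean of bounded variables. -/
theorem lintegral_exp_mean_deviation_le {Z : Type*} [MeasurableSpace Z] (P : Measure Z)
    [IsProbabilityMeasure P] {g : Z → ℝ} {C : ℝ} (hC : 0 ≤ C) (hg : Measurable g)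
    (hb : ∀ z, g z ∈ Set.Icc 0 C) {n : ℕ} (hn : 0 < n) (lam : ℝ) :
    ∫⁻ ω, ENNReal.ofReal (Real.exp (lam * ((∫ z, g z ∂P) - (∑ i, g (ω i)) / n)))
        ∂(Measure.pi fun _ : Fin n => P) ≤
      ENNReal.ofReal (Real.exp (lam * (lam * C ^ 2 / (8 * n)))) := by
  have hn' : (n : ℝ) ≠ 0 := by positivity
  have hsub := hasSubgaussianMGF_of_mem_Icc (μ := P) hg.aemeasurable
    (Filter.Eventually.of_forall hb)
  have hmgf := hsub.mgf_le (-(lam / n))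
  have hfac : ∀ ω : Fin n → Z,
      Real.exp (lam * ((∫ z, g z ∂P) - (∑ i, g (ω i)) / n)) =
        ∏ i, Real.exp (-(lam / n) * (g (ω i) - ∫ z, g z ∂P)) := by
    intro ω
    rw [← Real.exp_sum, ← Finset.mul_sum, Finset.sum_sub_distrib]
    simp only [Finset.sum_const, Finset.card_univ, Fintype.card_fin, nsmul_eq_mul]
    congr 1
    field_simp
    ring
  have hint : Integrable (fun ω : Fin n → Z =>
      ∏ i, Real.exp (-(lam / n) * (g (ω i) - ∫ z, g z ∂P))) (Measure.pi fun _ => P) :=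
    Integrable.fintype_prod fun _ => hsub.integrable_exp_mul _
  simp_rw [hfac]
  rw [← ofReal_integral_eq_lintegral_ofReal hint
    (Filter.Eventually.of_forall fun ω => Finset.prod_nonneg fun i _ => (Real.exp_pos _).le)]
  apply ENNReal.ofReal_le_ofReal
  rw [integral_fintype_prod_eq_pow
    (f := fun z => Real.exp (-(lam / n) * (g z - ∫ z, g z ∂P))), Fintype.card_fin]
  refine (pow_le_pow_left₀ (integral_nonneg fun _ => (Real.exp_pos _).le) hmgf n).trans ?_
  rw [← Real.exp_nat_mul]
  apply le_of_eq
  congr 1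
  simp only [sub_zero, NNReal.coe_pow, NNReal.coe_div, coe_nnnorm, Real.norm_eq_abs,
    abs_of_nonneg hC, NNReal.coe_ofNat]
  field_simp
  ring

/-- Markov's inequality as a lower bound on the probability of the good event. -/
theorem ofReal_one_sub_le_measure_lt {Ω : Type*} [MeasurableSpace Ω] {μ : Measure Ω}
    [IsProbabilityMeasure μ] {G : Ω → ℝ≥0∞} (hG : Measurable G) {M ε : ℝ} (hM : 0 < M)
    (hε : 0 < ε) (hle : ∫⁻ ω, G ω ∂μ ≤ ENNReal.ofReal M) :
    ENNReal.ofReal (1 - ε) ≤ μ {ω | G ω < ENNReal.ofReal (M / ε)} := by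
  have hs : MeasurableSet {ω | ENNReal.ofReal (M / ε) ≤ G ω} :=
    measurableSet_le measurable_const hG
  have hmarkov := (mul_meas_ge_le_lintegral (μ := μ) hG (ENNReal.ofReal (M / ε))).trans hle
  have hbad : μ {ω | ENNReal.ofReal (M / ε) ≤ G ω} ≤ ENNReal.ofReal ε := by
    have hpos : 0 < M / ε := by positivity
    rw [mul_comm, ← ENNReal.le_div_iff_mul_le (by simp [hpos]) (by simp),
      ← ENNReal.ofReal_div_of_pos hpos] at hmarkov
    rwa [div_div_cancel₀ hM.ne'] at hmarkov
  have hcompl : {ω | G ω < ENNReal.ofReal (M / ε)} =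
      {ω | ENNReal.ofReal (M / ε) ≤ G ω}ᶜ := by
    ext ω
    simp
  rw [hcompl, prob_compl_eq_one_sub hs, ENNReal.ofReal_sub _ hε.le, ENNReal.ofReal_one]
  exact tsub_le_tsub_left hbad 1

theorem measurable_empRisk_uncurry {X Y Θ : Type*} [MeasurableSpace X] [MeasurableSpace Y]
    [MeasurableSpace Θ] {f : Θ → X → Y} {ℓ : Y → Y → ℝ}
    (hmeas : Measurable (fun p : Θ × X × Y => ℓ (f p.1 p.2.1) p.2.2)) (n : ℕ) :
    Measurable fun q : (Fin n → X × Y) × Θ => empRisk f ℓ n q.1 q.2 := by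
  refine Measurable.div_const (Finset.measurable_sum _ fun i _ => ?_) _
  exact hmeas.comp (measurable_snd.prodMk ((measurable_pi_apply i).comp measurable_fst))

theorem empRisk_mem_Icc {X Y Θ : Type*} {f : Θ → X → Y} {ℓ : Y → Y → ℝ} {C : ℝ}
    (hbound : ∀ y' y : Y, ℓ y' y ∈ Set.Icc 0 C) {n : ℕ} (hn : 0 < n) (ω : Fin n → X × Y)
    (θ : Θ) : empRisk f ℓ n ω θ ∈ Set.Icc 0 C := by
  have hn' : (0 : ℝ) < n := by exact_mod_cast hn
  refine ⟨div_nonneg (Finset.sum_nonneg fun i _ => (hbound _ _).1) hn'.le, ?_⟩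
  rw [empRisk, div_le_iff₀ hn']
  calc _ ≤ ∑ _i : Fin n, C := Finset.sum_le_sum fun i _ => (hbound _ _).2
    _ = C * n := by simp [mul_comm]

theorem measurable_risk {X Y Θ : Type*} [MeasurableSpace X] [MeasurableSpace Y]
    [MeasurableSpace Θ] (P : Measure (X × Y)) [IsProbabilityMeasure P] {f : Θ → X → Y}
    {ℓ : Y → Y → ℝ} (hmeas : Measurable (fun p : Θ × X × Y => ℓ (f p.1 p.2.1) p.2.2)) :
    Measurable (risk P f ℓ) :=
  hmeas.stronglyMeasurable.integral_prod_right'.measurable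

theorem risk_mem_Icc {X Y Θ : Type*} [MeasurableSpace X] [MeasurableSpace Y]
    [MeasurableSpace Θ] (P : Measure (X × Y)) [IsProbabilityMeasure P] {f : Θ → X → Y}
    {ℓ : Y → Y → ℝ} {C : ℝ}
    (hmeas : Measurable (fun p : Θ × X × Y => ℓ (f p.1 p.2.1) p.2.2))
    (hbound : ∀ y' y : Y, ℓ y' y ∈ Set.Icc 0 C) (θ : Θ) : risk P f ℓ θ ∈ Set.Icc 0 C := by
  refine ⟨integral_nonneg fun p => (hbound _ _).1, ?_⟩
  calc risk P f ℓ θ ≤ ∫ _p, C ∂P :=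
        integral_mono (integrable_of_measurable_of_mem_Icc P
          (hmeas.comp measurable_prodMk_left) fun p => hbound _ _) (integrable_const _)
          fun p => (hbound _ _).2
    _ = C := by simp

/-- The Gibbs posterior `ρ̂_λ` (density `exp(-λ r θ)/E_π[exp(-λ r)]` w.r.t. `π`) minimizes
`ρ ↦ E_{θ∼ρ}[r(θ)] + KL(ρ‖π)/λ` over probability measures `ρ`; consequently, with
probability at least `1 - ε` over the sample,
`E_{θ∼ρ̂_λ}[R(θ)] ≤ inf_ρ ( E_{θ∼ρ}[r(θ)] + λC²/(8n) + (KL(ρ‖π) + log(1/ε))/λ )`. -/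
theorem gibbs_posterior_minimizes_and_pac_bayes_bound
    {X Y Θ : Type*} [MeasurableSpace X] [MeasurableSpace Y] [MeasurableSpace Θ]
    (P : Measure (X × Y)) [IsProbabilityMeasure P]
    (f : Θ → X → Y) (ℓ : Y → Y → ℝ) (C : ℝ) (hC : 0 < C)
    (hmeas : Measurable (fun p : Θ × X × Y => ℓ (f p.1 p.2.1) p.2.2))
    (hbound : ∀ y' y : Y, ℓ y' y ∈ Set.Icc 0 C)
    (π : Measure Θ) [IsProbabilityMeasure π]
    (n : ℕ) (hn : 0 < n) (lam ε : ℝ) (hlam : 0 < lam) (hε : ε ∈ Set.Ioo (0:ℝ) 1) :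
    (∀ ω : Fin n → X × Y, ∀ ρ : Measure Θ, IsProbabilityMeasure ρ →
        (∫⁻ θ, ENNReal.ofReal (empRisk f ℓ n ω θ) ∂(gibbs π f ℓ lam n ω))
            + KL (gibbs π f ℓ lam n ω) π / ENNReal.ofReal lam ≤
          (∫⁻ θ, ENNReal.ofReal (empRisk f ℓ n ω θ) ∂ρ)
            + KL ρ π / ENNReal.ofReal lam)
    ∧ ENNReal.ofReal (1 - ε) ≤
        (Measure.pi fun _ : Fin n => P)
          {ω | ∫⁻ θ, ENNReal.ofReal (risk P f ℓ θ) ∂(gibbs π f ℓ lam n ω) ≤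
            ⨅ ρ : {ρ : Measure Θ // IsProbabilityMeasure ρ},
              ((∫⁻ θ, ENNReal.ofReal (empRisk f ℓ n ω θ) ∂ρ.1)
                + ENNReal.ofReal (lam * C ^ 2 / (8 * n))
                + (KL ρ.1 π + ENNReal.ofReal (Real.log (1 / ε))) / ENNReal.ofReal lam)} := by
  have hr : ∀ ω : Fin n → X × Y, Measurable (empRisk f ℓ n ω) := fun ω =>
    (measurable_empRisk_uncurry hmeas n).comp measurable_prodMk_left
  have hrb : ∀ (ω : Fin n → X × Y) (θ : Θ), empRisk f ℓ n ω θ ∈ Set.Icc 0 C :=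
    empRisk_mem_Icc hbound hn
  have hR := measurable_risk P hmeas
  have hRb := risk_mem_Icc P hmeas hbound
  have hmin : ∀ ω : Fin n → X × Y, ∀ ρ : Measure Θ, IsProbabilityMeasure ρ →
      (∫⁻ θ, ENNReal.ofReal (empRisk f ℓ n ω θ) ∂(gibbs π f ℓ lam n ω))
          + KL (gibbs π f ℓ lam n ω) π / ENNReal.ofReal lam ≤
        (∫⁻ θ, ENNReal.ofReal (empRisk f ℓ n ω θ) ∂ρ) + KL ρ π / ENNReal.ofReal lam :=
    fun ω ρ _ => tilted_minimizes_lintegral_add_KL_div π (hr ω) (hrb ω) hlam ρ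
  refine ⟨hmin, ?_⟩
  set F : (Fin n → X × Y) → Θ → ℝ := fun ω θ =>
    Real.exp (lam * (risk P f ℓ θ - empRisk f ℓ n ω θ))
  have hFm : Measurable (Function.uncurry fun ω θ => ENNReal.ofReal (F ω θ)) :=
    (((hR.comp measurable_snd).sub
      (measurable_empRisk_uncurry hmeas n)).const_mul lam).exp.ennreal_ofReal
  set a : ℝ := lam * C ^ 2 / (8 * n) with ha
  have hint : ∫⁻ ω, ∫⁻ θ, ENNReal.ofReal (F ω θ) ∂π ∂(Measure.pi fun _ : Fin n => P) ≤
      ENNReal.ofReal (Real.exp (lam * a)) := by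
    rw [lintegral_lintegral_swap hFm.aemeasurable]
    refine (lintegral_mono fun θ => lintegral_exp_mean_deviation_le P hC.le
      (hmeas.comp measurable_prodMk_left) (fun p => hbound _ _) hn lam).trans ?_
    simp [ha]
  refine (ofReal_one_sub_le_measure_lt hFm.lintegral_prod_right' (Real.exp_pos _) hε.1
    hint).trans (measure_mono fun ω hω => ?_)
  have hexp : Integrable (F ω) π := by
    refine integrable_exp_of_measurable_of_mem_Icc π (a := lam * (0 - C)) (b := lam * (C - 0))
      ((hR.sub (hr ω)).const_mul _) fun θ => ⟨?_, ?_⟩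
    · exact mul_le_mul_of_nonneg_left (sub_le_sub (hRb θ).1 (hrb ω θ).2) hlam.le
    · exact mul_le_mul_of_nonneg_left (sub_le_sub (hRb θ).2 (hrb ω θ).1) hlam.le
  have hlog : Real.log (∫ θ, F ω θ ∂π) ≤ lam * a + Real.log (1 / ε) := by
    have hlt : ∫ θ, F ω θ ∂π < Real.exp (lam * a) / ε := by
      rw [← ENNReal.ofReal_lt_ofReal_iff (div_pos (Real.exp_pos _) hε.1),
        ofReal_integral_eq_lintegral_ofReal hexp
          (Filter.Eventually.of_forall fun θ => (Real.exp_pos _).le)]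
      exact hω
    rw [← Real.log_exp (lam * a), ← Real.log_mul (Real.exp_ne_zero _)
      (one_div_pos.2 hε.1).ne', mul_one_div]
    exact Real.log_le_log (integral_exp_pos hexp) hlt.le
  have hL : 0 ≤ Real.log (1 / ε) := Real.log_nonneg (one_le_one_div hε.1 hε.2.le)
  have hexpr : Integrable (fun θ => Real.exp (-lam * empRisk f ℓ n ω θ)) π := by
    refine integrable_exp_of_measurable_of_mem_Icc π (a := -lam * C) (b := 0)
      ((hr ω).const_mul _) fun θ => ⟨?_, ?_⟩
    · nlinarith [(hrb ω θ).2]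
    · nlinarith [(hrb ω θ).1]
  have : IsProbabilityMeasure (gibbs π f ℓ lam n ω) := isProbabilityMeasure_tilted hexpr
  refine (lintegral_le_of_log_integral_exp_le hR (hr ω) hRb (hrb ω) hlam
    (by positivity) hL hlog (gibbs π f ℓ lam n ω)).trans (le_iInf fun ρ => ?_)
  have hsplit : ∀ u k c : ℝ≥0∞, u + ENNReal.ofReal a + (k + c) / ENNReal.ofReal lam =
      u + k / ENNReal.ofReal lam + (ENNReal.ofReal a + c / ENNReal.ofReal lam) := fun u k c => by
    rw [ENNReal.add_div, add_add_add_comm]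
  rw [hsplit, hsplit]
  exact add_le_add (hmin ω ρ.1 ρ.2) le_rfl
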